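/- arXiv:1401.2325 — 5 statements merged into one kernel-verified Lean document; each statement's English description precedes it below -/
import Mathlib

section
/- Let α, R be real numbers and x ≥ 0. Define a_S²(α; R) = α/2 if α ≤ √2·|R|, and a_S²(α; R) = (α + √(α² − 2R²))/2 if α > √2·|R|. Then the quadratic λ² + 2(2x − α)λ + 2x(x − α) + R² has a complex root λ with Re λ > 0 if and only if x < a_S²(α; R). -/
theorem quad_aux (b c : ℝ) :
    (∃ lam : ℂ, lam ^ 2 + 2 * (b : ℂ) * lam + (c : ℂ) = 0 ∧ 0 < lam.re) ↔ (b < 0 ∨ c < 0) := by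
  constructor
  · rintro ⟨l, h, hl⟩
    by_contra! hc
    obtain ⟨hb, hc⟩ := hc
    have h1 := congrArg Complex.re h
    have h2 := congrArg Complex.im h
    simp [pow_two] at h1 h2
    have h3 : l.im * (l.re + b) = 0 := by linarith
    have h4 : l.im = 0 := by
      rcases mul_eq_zero.1 h3 with h | h
      · exact h
      · linarith
    rw [h4] at h1
    nlinarith [mul_pos hl hl, mul_nonneg hb hl.le]
  · intro h
    by_cases hD : 0 ≤ b ^ 2 - c
    · have hs := Real.sq_sqrt hD
      have hn := Real.sqrt_nonneg (b ^ 2 - c)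
      refine ⟨((-b + Real.sqrt (b ^ 2 - c) : ℝ) : ℂ), ?_, ?_⟩
      · norm_cast
        linear_combination hs
      · rw [Complex.ofReal_re]
        rcases h with h | h
        · linarith
        · by_contra! h'
          nlinarith
    · push Not at hD
      have hs := Real.sq_sqrt (show 0 ≤ -(b ^ 2 - c) by linarith)
      refine ⟨⟨-b, Real.sqrt (-(b ^ 2 - c))⟩, ?_, ?_⟩
      · apply Complex.ext
        · simp [pow_two] at hs ⊢
          linarith
        · simp [pow_two]
          ring
      · rcases h with h | h
        · simpa using h
        · nlinarith [sq_nonneg b]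

/-- The strong-spectrum quadratic
`λ² + 2(2x−α)λ + 2x(x−α) + R²` (with `x = a²`) has a root with positive real
part if and only if `x < a_S²(α;R)`, where `a_S²(α;R) = α/2` for
`α ≤ √2·|R|` and `a_S²(α;R) = (α + √(α² − 2R²))/2` for `α > √2·|R|`. -/
theorem stuart_landau_strong_instability_threshold
    (α R x : ℝ) (hx : 0 ≤ x) (aS2 : ℝ)
    (haS2 : aS2 = if α ≤ Real.sqrt 2 * |R| then α / 2
      else (α + Real.sqrt (α ^ 2 - 2 * R ^ 2)) / 2) :
    (∃ lam : ℂ,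
      lam ^ 2 + 2 * ((2 * x - α : ℝ) : ℂ) * lam + ((2 * x * (x - α) + R ^ 2 : ℝ) : ℂ) = 0
        ∧ 0 < lam.re)
    ↔ x < aS2 := by
  rw [quad_aux, haS2]
  have h2 : Real.sqrt 2 ^ 2 = 2 := Real.sq_sqrt (by norm_num)
  have hR : |R| ^ 2 = R ^ 2 := sq_abs R
  have hm : (Real.sqrt 2 * |R|) ^ 2 = 2 * R ^ 2 := by rw [mul_pow, h2, hR]
  have hm0 : 0 ≤ Real.sqrt 2 * |R| := by positivity
  generalize Real.sqrt 2 * |R| = m at *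
  split_ifs with h
  · constructor
    · rintro (h1 | h1)
      · linarith
      · by_contra! h3
        rcases le_or_gt 0 α with h0 | h0
        · nlinarith [sq_nonneg (2 * x - α)]
        · nlinarith [mul_nonneg hx (show 0 ≤ x - α by linarith), sq_nonneg R]
    · intro h1
      left; linarith
  · push Not at h
    have hp : 0 < α ^ 2 - 2 * R ^ 2 := by nlinarith
    have hs := Real.sq_sqrt hp.le
    have hn := Real.sqrt_pos.2 hp
    generalize Real.sqrt (α ^ 2 - 2 * R ^ 2) = s at *
    constructor
    · rintro (h1 | h1)
      · linarith
      · by_contra! h3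
        nlinarith
    · intro h1
      by_cases h3 : 2 * x - α < 0
      · exact Or.inl h3
      · right
        push Not at h3
        nlinarith
end

section
/- Let α, β, C, τ, a, Ω, k₁, k₂, q₁, q₂ be real numbers and λ ∈ ℂ. Set k₊ = (k₁+k₂)/2, k₋ = (k₁−k₂)/2, q₊ = (q₁+q₂)/2, q₋ = (q₁−q₂)/2, R = C·cos(k₋), R₊ = C·cos(k₋+q₋), R₋ = C·cos(k₋−q₋), k_τ = k₊ − Ωτ. Assume the plane-wave relations a² = α + R·cos(k_τ) and Ω = β + R·sin(k_τ). Then the determinant of the 2×2 complex matrix with entries M₁₁ = α + iβ − iΩ − λ − 2a² + (C/2)e^{−(λ+iΩ)τ}(e^{i(k₁+q₁)} + e^{i(k₂+q₂)}), M₁₂ = −a², M₂₁ = −a², M₂₂ = α − iβ + iΩ − λ − 2a² + (C/2)e^{−(λ−iΩ)τ}(e^{−i(k₁−q₁)} + e^{−i(k₂−q₂)}) equals χ(λ, q₋, q₊) = λ² + 2(a² + R·cos k_τ)λ + R² + 2Ra²·cos k_τ + R₊R₋·e^{−2λτ+2iq₊} − [(a² + R·cos k_τ + λ)(R₊e^{ik_τ}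 + R₋e^{−ik_τ}) − iR·sin k_τ·(R₊e^{ik_τ} − R₋e^{−ik_τ})]·e^{−λτ+iq₊}. -/
open Complex

/-- For a plane wave of the Stuart–Landau lattice (satisfying the
amplitude/frequency relations), the determinant of the 2×2 linear system arising
from the Bloch ansatz equals the characteristic function `χ(λ, q₋, q₊)`. -/
theorem stuart_landau_plane_wave_characteristic_determinant
    (α β C τ a Ω k₁ k₂ q₁ q₂ : ℝ) (lam : ℂ)
    (kp km qp qm R Rp Rm kτ : ℝ)
    (hkp : kp = (k₁ + k₂) / 2) (hkm : km = (k₁ - k₂) / 2)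
    (hqp : qp = (q₁ + q₂) / 2) (hqm : qm = (q₁ - q₂) / 2)
    (hR : R = C * Real.cos km) (hRp : Rp = C * Real.cos (km + qm))
    (hRm : Rm = C * Real.cos (km - qm)) (hkτ : kτ = kp - Ω * τ)
    (hamp : a ^ 2 = α + R * Real.cos kτ) (hfreq : Ω = β + R * Real.sin kτ) :
    Matrix.det
      !![(α : ℂ) + Complex.I * β - Complex.I * Ω - lam - 2 * (a : ℂ) ^ 2
            + (C / 2 : ℂ) * Complex.exp (-(lam + Complex.I * Ω) * τ)
              * (Complex.exp (Complex.I * ((k₁ + q₁ : ℝ) : ℂ))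
                + Complex.exp (Complex.I * ((k₂ + q₂ : ℝ) : ℂ))),
          -(a : ℂ) ^ 2;
          -(a : ℂ) ^ 2,
          (α : ℂ) - Complex.I * β + Complex.I * Ω - lam - 2 * (a : ℂ) ^ 2
            + (C / 2 : ℂ) * Complex.exp (-(lam - Complex.I * Ω) * τ)
              * (Complex.exp (-Complex.I * ((k₁ - q₁ : ℝ) : ℂ))
                + Complex.exp (-Complex.I * ((k₂ - q₂ : ℝ) : ℂ)))]
    = lam ^ 2 + 2 * ((a ^ 2 + R * Real.cos kτ : ℝ) : ℂ) * lam
        + ((R ^ 2 + 2 * R * a ^ 2 * Real.cos kτ : ℝ) : ℂ)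
        + ((Rp * Rm : ℝ) : ℂ) * Complex.exp (-2 * lam * τ + 2 * Complex.I * qp)
        - ((((a ^ 2 + R * Real.cos kτ : ℝ) : ℂ) + lam)
              * ((Rp : ℂ) * Complex.exp (Complex.I * kτ)
                + (Rm : ℂ) * Complex.exp (-Complex.I * kτ))
            - Complex.I * ((R * Real.sin kτ : ℝ) : ℂ)
              * ((Rp : ℂ) * Complex.exp (Complex.I * kτ)
                - (Rm : ℂ) * Complex.exp (-Complex.I * kτ)))
          * Complex.exp (-lam * τ + Complex.I * qp) := by
  have hP : (C / 2 : ℂ) * Complex.exp (-(lam + Complex.I * Ω) * τ)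
              * (Complex.exp (Complex.I * ((k₁ + q₁ : ℝ) : ℂ))
                + Complex.exp (Complex.I * ((k₂ + q₂ : ℝ) : ℂ)))
      = (Rp : ℂ) * Complex.exp (Complex.I * kτ) * Complex.exp (-lam * τ + Complex.I * qp) := by
    rw [hRp, hkτ, hkp, hqp, hkm, hqm]
    push_cast
    rw [Complex.cos]
    have e : ∀ x y z : ℂ, (C : ℂ) * ((x + y) / 2) * z = C / 2 * (x * z + y * z) := by
      intros; ring
    rw [mul_assoc, mul_assoc, e, mul_add, ← Complex.exp_add, ← Complex.exp_add, ← Complex.exp_add,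
      ← Complex.exp_add, ← Complex.exp_add]
    congr 3 <;> ring
  have hQ : (C / 2 : ℂ) * Complex.exp (-(lam - Complex.I * Ω) * τ)
              * (Complex.exp (-Complex.I * ((k₁ - q₁ : ℝ) : ℂ))
                + Complex.exp (-Complex.I * ((k₂ - q₂ : ℝ) : ℂ)))
      = (Rm : ℂ) * Complex.exp (-Complex.I * kτ) * Complex.exp (-lam * τ + Complex.I * qp) := by
    rw [hRm, hkτ, hkp, hqp, hkm, hqm]
    push_cast
    rw [Complex.cos]
    have e : ∀ x y z : ℂ, (C : ℂ) * ((x + y) / 2) * z = C / 2 * (y * z + x * z) := by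
      intros; ring
    rw [mul_assoc, mul_assoc, e, mul_add, ← Complex.exp_add, ← Complex.exp_add, ← Complex.exp_add,
      ← Complex.exp_add, ← Complex.exp_add]
    congr 3 <;> ring
  have hE : Complex.exp (-2 * lam * τ + 2 * Complex.I * qp)
      = Complex.exp (-lam * τ + Complex.I * qp) ^ 2 := by
    rw [← Complex.exp_nat_mul]; congr 1; push_cast; ring
  have hK : Complex.exp (Complex.I * kτ) * Complex.exp (-Complex.I * kτ) = 1 := by
    rw [← Complex.exp_add]; simp
  have hα : (α : ℂ) = (a : ℂ) ^ 2 - R * (Real.cos kτ : ℝ) := by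
    have : α = a ^ 2 - R * Real.cos kτ := by linarith
    rw [this]; push_cast; ring
  have hβ : (β : ℂ) = (Ω : ℂ) - R * (Real.sin kτ : ℝ) := by
    have : β = Ω - R * Real.sin kτ := by linarith
    rw [this]; push_cast; ring
  have hs : ((Real.sin kτ : ℝ) : ℂ) ^ 2 + ((Real.cos kτ : ℝ) : ℂ) ^ 2 = 1 := by
    exact_mod_cast Real.sin_sq_add_cos_sq kτ
  rw [Matrix.det_fin_two_of, hP, hQ, hE, hα, hβ]
  simp only [Complex.ofReal_add, Complex.ofReal_mul, Complex.ofReal_pow, Complex.ofReal_ofNat]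
  generalize Complex.exp (-lam * τ + Complex.I * qp) = E at *
  generalize Complex.exp (Complex.I * kτ) = u at *
  generalize Complex.exp (-Complex.I * kτ) = v at *
  generalize ((Real.sin kτ : ℝ) : ℂ) = s at *
  generalize ((Real.cos kτ : ℝ) : ℂ) = c at *
  linear_combination (R : ℂ) ^ 2 * hs + (Rp : ℂ) * Rm * E ^ 2 * hK - (R : ℂ) ^ 2 * s ^ 2 * Complex.I_sq
end

section
/- Let α, β, C, τ, a, Ω, k₁, k₂, q₁, q₂ be real numbers, λ ∈ ℂ, and b₁, b₂ ∈ ℂ. Suppose (b₁, b₂) satisfies the linear system [α + iβ − iΩ − λ − 2a² + (C/2)e^{−(λ+iΩ)τ}(e^{i(k₁+q₁)} + e^{i(k₂+q₂)})]·b₁ − a²·b₂ = 0 and −a²·b₁ + [α − iβ + iΩ − λ − 2a² + (C/2)e^{−(λ−iΩ)τ}(e^{−i(k₁−q₁)} + e^{−i(k₂−q₂)})]·b₂ = 0. Then the functions ξ_{m,n}(t) = b₁·e^{λt − iq₁m − iq₂n} + conj(b₂)·e^{conj(λ)·t + iq₁m + iq₂n}, (m,n) ∈ ℤ², satisfy ξ_{m,n}'(t)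 = (α + iβ − iΩ − 2a²)ξ_{m,n}(t) − a²·conj(ξ_{m,n}(t)) + (C/2)e^{−iΩτ}(e^{ik₁}ξ_{m−1,n}(t−τ) + e^{ik₂}ξ_{m,n−1}(t−τ)) for all (m,n) ∈ ℤ² and all t ∈ ℝ. -/
open Complex

/-- If `(b₁, b₂)` solves the 2×2 linear system obtained from the
Bloch ansatz, then `ξ_{m,n}(t) = b₁e^{λt−iq₁m−iq₂n} + b₂*e^{λ*t+iq₁m+iq₂n}`
solves the linearized (co-rotating) equation for perturbations of a plane wave
of the Stuart–Landau lattice. -/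
theorem stuart_landau_bloch_ansatz_solves_linearization
    (α β C τ a Ω k₁ k₂ q₁ q₂ : ℝ) (lam b₁ b₂ : ℂ)
    (h₁ : ((α : ℂ) + Complex.I * β - Complex.I * Ω - lam - 2 * (a : ℂ) ^ 2
        + (C / 2 : ℂ) * Complex.exp (-(lam + Complex.I * Ω) * τ)
          * (Complex.exp (Complex.I * ((k₁ + q₁ : ℝ) : ℂ))
            + Complex.exp (Complex.I * ((k₂ + q₂ : ℝ) : ℂ)))) * b₁
        - (a : ℂ) ^ 2 * b₂ = 0)
    (h₂ : -(a : ℂ) ^ 2 * b₁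
        + ((α : ℂ) - Complex.I * β + Complex.I * Ω - lam - 2 * (a : ℂ) ^ 2
          + (C / 2 : ℂ) * Complex.exp (-(lam - Complex.I * Ω) * τ)
            * (Complex.exp (-Complex.I * ((k₁ - q₁ : ℝ) : ℂ))
              + Complex.exp (-Complex.I * ((k₂ - q₂ : ℝ) : ℂ)))) * b₂ = 0)
    (ξ : ℤ → ℤ → ℝ → ℂ)
    (hξ : ∀ m n : ℤ, ∀ t : ℝ,
      ξ m n t = b₁ * Complex.exp (lam * t - Complex.I * q₁ * m - Complex.I * q₂ * n)
        + (starRingEnd ℂ) b₂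
          * Complex.exp ((starRingEnd ℂ) lam * t + Complex.I * q₁ * m + Complex.I * q₂ * n)) :
    ∀ m n : ℤ, ∀ t : ℝ,
      HasDerivAt (ξ m n)
        (((α : ℂ) + Complex.I * β - Complex.I * Ω - 2 * (a : ℂ) ^ 2) * ξ m n t
          - (a : ℂ) ^ 2 * (starRingEnd ℂ) (ξ m n t)
          + (C / 2 : ℂ) * Complex.exp (-Complex.I * Ω * τ)
            * (Complex.exp (Complex.I * k₁) * ξ (m - 1) n (t - τ)
              + Complex.exp (Complex.I * k₂) * ξ m (n - 1) (t - τ))) t := by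
  intro m n t
  have h₃ := congrArg (starRingEnd ℂ) h₂
  simp only [map_add, map_mul, map_sub, map_neg, map_pow, map_div₀, map_zero, map_ofNat,
    Complex.conj_ofReal, Complex.conj_I, ← Complex.exp_conj] at h₃
  have hd : HasDerivAt (ξ m n)
      (b₁ * (Complex.exp (lam * t - Complex.I * q₁ * m - Complex.I * q₂ * n) * lam)
        + (starRingEnd ℂ) b₂ * (Complex.exp ((starRingEnd ℂ) lam * t + Complex.I * q₁ * m
          + Complex.I * q₂ * n) * (starRingEnd ℂ) lam)) t := by
    have hf : ξ m n = fun t : ℝ => b₁ * Complex.exp (lam * t - Complex.I * q₁ * m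
        - Complex.I * q₂ * n) + (starRingEnd ℂ) b₂
          * Complex.exp ((starRingEnd ℂ) lam * t + Complex.I * q₁ * m + Complex.I * q₂ * n) :=
      funext (hξ m n)
    rw [hf]
    have hl : ∀ c : ℂ, HasDerivAt (fun t : ℝ => c * (t : ℂ)) c t := fun c => by
      simpa using (Complex.ofRealCLM.hasDerivAt (x := t)).const_mul c
    exact ((((hl lam).sub_const _).sub_const _).cexp.const_mul b₁).add
      ((((hl _).add_const _).add_const _).cexp.const_mul _)
  convert hd using 1
  simp only [hξ]
  set l' := (starRingEnd ℂ) lam with hl'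
  have c1 : (starRingEnd ℂ) (Complex.exp (lam * t - Complex.I * q₁ * m - Complex.I * q₂ * n))
      = Complex.exp (l' * t + Complex.I * q₁ * m + Complex.I * q₂ * n) := by
    rw [← Complex.exp_conj]
    congr 1
    simp [hl']
  have c2 : (starRingEnd ℂ) (Complex.exp (l' * t + Complex.I * q₁ * m + Complex.I * q₂ * n))
      = Complex.exp (lam * t - Complex.I * q₁ * m - Complex.I * q₂ * n) := by
    rw [← c1, Complex.conj_conj]
  rw [map_add, map_mul, map_mul, c1, c2, Complex.conj_conj]
  set E₁ := Complex.exp (lam * t - Complex.I * q₁ * m - Complex.I * q₂ * n) with hE₁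
  set E₂ := Complex.exp (l' * t + Complex.I * q₁ * m + Complex.I * q₂ * n) with hE₂
  have d1 : Complex.exp (-Complex.I * Ω * τ) * Complex.exp (Complex.I * k₁) *
      Complex.exp (lam * ((t - τ : ℝ) : ℂ) - Complex.I * q₁ * ((m - 1 : ℤ) : ℂ) - Complex.I * q₂ * n)
      = Complex.exp (-(lam + Complex.I * Ω) * τ) * Complex.exp (Complex.I * ((k₁ + q₁ : ℝ) : ℂ))
        * E₁ := by
    rw [hE₁]
    simp only [← Complex.exp_add]
    congr 1
    push_cast
    ring
  have d2 : Complex.exp (-Complex.I * Ω * τ) * Complex.exp (Complex.I * k₂) *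
      Complex.exp (lam * ((t - τ : ℝ) : ℂ) - Complex.I * q₁ * m - Complex.I * q₂ * ((n - 1 : ℤ) : ℂ))
      = Complex.exp (-(lam + Complex.I * Ω) * τ) * Complex.exp (Complex.I * ((k₂ + q₂ : ℝ) : ℂ))
        * E₁ := by
    rw [hE₁]
    simp only [← Complex.exp_add]
    congr 1
    push_cast
    ring
  have d3 : Complex.exp (-Complex.I * Ω * τ) * Complex.exp (Complex.I * k₁) *
      Complex.exp (l' * ((t - τ : ℝ) : ℂ) + Complex.I * q₁ * ((m - 1 : ℤ) : ℂ) + Complex.I * q₂ * n)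
      = Complex.exp (-(l' - -Complex.I * Ω) * τ) * Complex.exp (- -Complex.I * ((k₁ - q₁ : ℝ) : ℂ))
        * E₂ := by
    rw [hE₂]
    simp only [← Complex.exp_add]
    congr 1
    push_cast
    ring
  have d4 : Complex.exp (-Complex.I * Ω * τ) * Complex.exp (Complex.I * k₂) *
      Complex.exp (l' * ((t - τ : ℝ) : ℂ) + Complex.I * q₁ * m + Complex.I * q₂ * ((n - 1 : ℤ) : ℂ))
      = Complex.exp (-(l' - -Complex.I * Ω) * τ) * Complex.exp (- -Complex.I * ((k₂ - q₂ : ℝ) : ℂ))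
        * E₂ := by
    rw [hE₂]
    simp only [← Complex.exp_add]
    congr 1
    push_cast
    ring
  linear_combination E₁ * h₁ + E₂ * h₃ + (C / 2 : ℂ) * b₁ * (d1 + d2)
    + (C / 2 : ℂ) * (starRingEnd ℂ) b₂ * (d3 + d4)
end

section
/- Let a > 0, R > 0 and k₋, k_τ be real numbers with cos k_τ > 0 and cos k₋ ≠ 0. Define the symmetric 2×2 real matrix H with entries H₁₁ = (1/(R²cos²k_τ))·((R/a²)·(sin²k_τ/cos k_τ) − 1), H₂₂ = −1 + (R·tan²k₋)/(a²·cos³k_τ) + tan²k₋·tan²k_τ, and H₁₂ = H₂₁ = (tan k₋·tan k_τ)/(a²·cos²k_τ). Then H is negative definite if and only if (cos²k_τ − sin²k₋)·(R·cos k_τ + a²) − R·cos k_τ > 0. -/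
open Matrix

theorem negdef_two_iff (P Q S : ℝ) :
    (∀ x : Fin 2 → ℝ, x ≠ 0 → x ⬝ᵥ (!![P, Q; Q, S] *ᵥ x) < 0) ↔ P < 0 ∧ 0 < P * S - Q ^ 2 := by
  have key : ∀ x : Fin 2 → ℝ, x ⬝ᵥ (!![P, Q; Q, S] *ᵥ x)
      = P * x 0 ^ 2 + 2 * Q * x 0 * x 1 + S * x 1 ^ 2 := by
    intro x
    simp [Matrix.mulVec, dotProduct, Fin.sum_univ_two]
    ring
  constructor
  · intro h
    have hP : P < 0 := by
      have h1 := h ![1, 0] (by intro h0; simpa using congrFun h0 0)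
      rw [key] at h1
      simpa using h1
    refine ⟨hP, ?_⟩
    have h2 := h ![-Q, P] (by intro h0; exact hP.ne (by simpa using congrFun h0 1))
    rw [key] at h2
    simp at h2
    by_contra hn
    push Not at hn
    nlinarith [mul_nonneg_of_nonpos_of_nonpos hP.le hn]
  · rintro ⟨hP, hD⟩ x hx
    rw [key]
    have e : P * (P * x 0 ^ 2 + 2 * Q * x 0 * x 1 + S * x 1 ^ 2)
        = (P * x 0 + Q * x 1) ^ 2 + (P * S - Q ^ 2) * x 1 ^ 2 := by ring
    have hpos : 0 < P * (P * x 0 ^ 2 + 2 * Q * x 0 * x 1 + S * x 1 ^ 2) := by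
      rw [e]
      by_cases h1 : x 1 = 0
      · have h0 : x 0 ≠ 0 := by
          intro h0
          apply hx
          ext i
          fin_cases i
          · exact h0
          · exact h1
        rw [h1]
        have : 0 < (P * x 0) ^ 2 := by
          have := mul_ne_zero hP.ne h0
          positivity
        simpa using this
      · have : 0 < x 1 ^ 2 := by positivity
        have := mul_pos hD this
        positivity
    exact neg_of_mul_pos_right hpos hP.le

/-- The Hessian `H` of the pseudo-continuous spectrum branch
`γ₋` at the trivial Floquet multiplier `(ω, q₋) = (0,0)` is negative definite
(i.e. `xᵀHx < 0` for all nonzero `x`) if and only if the modulational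
stability condition `(cos²k_τ − sin²k₋)(R·cos k_τ + a²) − R·cos k_τ > 0` holds. -/
theorem stuart_landau_modulational_stability_hessian
    (a R km kτ : ℝ) (ha : 0 < a) (hRpos : 0 < R)
    (hkτ : 0 < Real.cos kτ) (hkm : Real.cos km ≠ 0)
    (H : Matrix (Fin 2) (Fin 2) ℝ)
    (hH : H = !![(1 / (R ^ 2 * Real.cos kτ ^ 2))
          * ((R / a ^ 2) * (Real.sin kτ ^ 2 / Real.cos kτ) - 1),
        (Real.tan km * Real.tan kτ) / (a ^ 2 * Real.cos kτ ^ 2);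
        (Real.tan km * Real.tan kτ) / (a ^ 2 * Real.cos kτ ^ 2),
        -1 + (R * Real.tan km ^ 2) / (a ^ 2 * Real.cos kτ ^ 3)
          + Real.tan km ^ 2 * Real.tan kτ ^ 2]) :
    (∀ x : Fin 2 → ℝ, x ≠ 0 → x ⬝ᵥ (H *ᵥ x) < 0) ↔
      0 < (Real.cos kτ ^ 2 - Real.sin km ^ 2) * (R * Real.cos kτ + a ^ 2)
        - R * Real.cos kτ := by
  subst hH
  rw [negdef_two_iff]
  have hs := Real.sin_sq_add_cos_sq kτ
  have hm := Real.sin_sq_add_cos_sq km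
  rw [Real.tan_eq_sin_div_cos, Real.tan_eq_sin_div_cos]
  generalize Real.cos kτ = c at *
  generalize Real.sin kτ = s at *
  generalize Real.cos km = m at *
  generalize Real.sin km = n at *
  set G := (c ^ 2 - n ^ 2) * (R * c + a ^ 2) - R * c with hG
  have hm2 : 0 < m ^ 2 := by positivity
  have hs2 : s ^ 2 = 1 - c ^ 2 := by linarith
  have hn2 : n ^ 2 = 1 - m ^ 2 := by linarith
  have hP : 1 / (R ^ 2 * c ^ 2) * (R / a ^ 2 * (s ^ 2 / c) - 1)
      = (R * s ^ 2 - a ^ 2 * c) / (a ^ 2 * R ^ 2 * c ^ 3) := by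
    field_simp
  have hD : 1 / (R ^ 2 * c ^ 2) * (R / a ^ 2 * (s ^ 2 / c) - 1)
      * (-1 + R * (n / m) ^ 2 / (a ^ 2 * c ^ 3) + (n / m) ^ 2 * (s / c) ^ 2)
      - (n / m * (s / c) / (a ^ 2 * c ^ 2)) ^ 2 = G / (a ^ 2 * R ^ 2 * c ^ 4 * m ^ 2) := by
    rw [hG]
    simp only [div_pow, mul_pow, hs2, hn2]
    field_simp
    ring
  rw [hD, hP]
  constructor
  · rintro ⟨-, h⟩
    exact (div_pos_iff_of_pos_right (by positivity)).1 h
  · intro h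
    refine ⟨div_neg_of_neg_of_pos ?_ (by positivity), by positivity⟩
    have e : G = m ^ 2 * c * (a ^ 2 * c - R * s ^ 2) - a ^ 2 * n ^ 2 * s ^ 2
        - R * c * n ^ 2 * (1 + s ^ 2) := by
      rw [hG, hs2, hn2]; ring
    have h1 : 0 ≤ a ^ 2 * n ^ 2 * s ^ 2 := by positivity
    have h2 : 0 ≤ R * c * n ^ 2 * (1 + s ^ 2) := by positivity
    have h3 : 0 < m ^ 2 * c * (a ^ 2 * c - R * s ^ 2) := by linarith
    have h4 := pos_of_mul_pos_right h3 (by positivity)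
    linarith
end

section
/- Let M, N, d be positive integers, F : ℝ^d × ℝ^d → ℝ^d a function, τ and T real numbers, and u₀ : ℝ → ℝ^d a differentiable function with u₀(t + T) = u₀(t) for all t and u₀'(t) = F(u₀(t), u₀(t−τ) + u₀(t−τ)) for all t (i.e., the synchronous state u_{m,n} ≡ u₀ is a T-periodic solution of the homogeneous-delay lattice). Let η : (ℤ/Mℤ) × (ℤ/Nℤ) → ℝ be arbitrary. Then the functions v_{m,n}(t) = u₀(t + η_{m,n}) satisfy v_{m,n}(t + T) = v_{m,n}(t) for all t and solve the inhomogeneous-delay lattice system v_{m,n}'(t) = F(v_{m,n}(t), v_{m−1,n}(t − τ↓_{m,n}) + v_{m,n−1}(t − τ→_{m,n})) with delays τ↓_{m,n} = τ − η_{m,n} + η_{m−1,n} and τ→_{m,n} = τ − η_{m,n} + η_{m,n−1}, for all (m,n) ∈ (ℤ/Mℤ) × (ℤ/Nℤ) and all t ∈ ℝ. -/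
/-- If `u₀` is a `T`-periodic synchronous solution of the
homogeneous-delay lattice (i.e. `u₀'(t) = F(u₀(t), u₀(t−τ) + u₀(t−τ))`), then
for arbitrary time shifts `η` the functions `v_{m,n}(t) = u₀(t + η_{m,n})` are
`T`-periodic and solve the lattice with inhomogeneous delays
`τ↓_{m,n} = τ − η_{m,n} + η_{m−1,n}`, `τ→_{m,n} = τ − η_{m,n} + η_{m,n−1}`. -/
theorem timeshift_of_synchronous_periodic_solution
    (M N d : ℕ) (hM : 0 < M) (hN : 0 < N) (hd : 0 < d)
    (F : (Fin d → ℝ) → (Fin d → ℝ) → (Fin d → ℝ)) (τ T : ℝ)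
    (u₀ : ℝ → (Fin d → ℝ))
    (hper : ∀ t : ℝ, u₀ (t + T) = u₀ t)
    (hu₀ : ∀ t : ℝ, HasDerivAt u₀ (F (u₀ t) (u₀ (t - τ) + u₀ (t - τ))) t)
    (η : ZMod M → ZMod N → ℝ)
    (v : ZMod M → ZMod N → ℝ → (Fin d → ℝ))
    (hv : ∀ (m : ZMod M) (n : ZMod N) (t : ℝ), v m n t = u₀ (t + η m n)) :
    (∀ (m : ZMod M) (n : ZMod N) (t : ℝ), v m n (t + T) = v m n t) ∧
      (∀ (m : ZMod M) (n : ZMod N) (t : ℝ),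
        HasDerivAt (v m n)
          (F (v m n t)
            (v (m - 1) n (t - (τ - η m n + η (m - 1) n))
              + v m (n - 1) (t - (τ - η m n + η m (n - 1))))) t) := by
  refine ⟨fun m n t => ?_, fun m n t => ?_⟩
  · rw [hv, hv, ← hper (t + η m n)]
    congr 1
    ring
  · have h1 : v m n = fun s => u₀ (s + η m n) := funext (hv m n)
    have h2 : t - (τ - η m n + η (m - 1) n) + η (m - 1) n = t + η m n - τ := by ring
    have h3 : t - (τ - η m n + η m (n - 1)) + η m (n - 1) = t + η m n - τ := by ring
    rw [hv (m - 1) n, hv m (n - 1), h2, h3, hv m n t, h1]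
    exact (hu₀ (t + η m n)).comp_add_const t (η m n)
end
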